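/- Let 0 < α < 1, let H : ℝ × ℝ → ℝ be continuously differentiable, and let (x,p) : [0,∞) → ℝ × ℝ be a bounded C¹ solution with bounded derivatives of the canonical equations x′(t) = ∂₂H(x(t),p(t)), p′(t) = −∂₁H(x(t),p(t)). Let p_t(τ) be a measurable family of nonnegative functions satisfying ∫₀^∞ e^{−st} p_t(τ) dt = s^{α−1} e^{−τ s^α} for all s > 0, τ ≥ 0, and define x_α(t) = ∫₀^∞ p_t(τ) x(τ) dτ and p_α(t) = ∫₀^∞ p_t(τ) p(τ) dτ, assumed C¹ on (0,∞) with all relevant functions of t continuous and of at most exponential order. Then the commutation condition — ∂₁H(x_α(t),p_α(t)) = ∫₀^∞ p_t(τ) ∂₁H(x(τ),p(τ)) dτ and ∂₂H(x_α(t),p_α(t)) = ∫₀^∞ p_t(τ) ∂₂H(x(τ),p(τ)) dτ for all t > 0 — holds if and only if (x_α,p_α) satisfies the fractional Hamiltonian equations (ᶜD^α_{0+} x_α)(t) = ∂₂H(x_α(t),p_α(t)) and (ᶜD^α_{0+} p_α)(t) = −∂₁H(x_α(t),p_α(t)) for all t > 0. -/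

import Mathlib

open MeasureTheory Set

/-- The left Caputo derivative of order `α` with base point `a`. -/
noncomputable def caputoL (a α : ℝ) (f : ℝ → ℝ) (t : ℝ) : ℝ :=
  (Real.Gamma (1 - α))⁻¹ * ∫ τ in a..t, (t - τ) ^ (-α) * deriv f τ


theorem lap_zero (h : ℝ → ℝ) (hi : IntegrableOn h (Ioi 0))
    (hz : ∀ n : ℕ, ∫ t in Ioi (0:ℝ), Real.exp (-t) ^ n * h t = 0) :
    ∀ᵐ t, t ∈ Ioi (0:ℝ) → h t = 0 := by
  refine isOpen_Ioi.ae_eq_zero_of_integral_contDiff_smul_eq_zero hi.locallyIntegrableOn ?_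
  intro g hg hgc hgs
  have hg0 : ∀ t ≤ 0, g t = 0 := fun t ht => by
    by_contra hne
    exact absurd (hgs (subset_tsupport _ hne)) (not_lt.mpr ht)
  have hcont : ContinuousOn (fun u => g (-Real.log u)) (Icc 0 1) := by
    intro u hu
    rcases hu.1.eq_or_lt with rfl | hu0
    · have : Filter.Tendsto (fun u => g (-Real.log u)) (nhdsWithin 0 (Ioi 0)) (nhds 0) := by
        have h1 : Filter.Tendsto g Filter.atTop (nhds 0) := by
          have := hgc.is_zero_at_infty
          exact this.mono_left (atTop_le_cocompact)
        exact h1.comp (Filter.tendsto_neg_atBot_atTop.comp Real.tendsto_log_nhdsGT_zero)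
      have h2 : ContinuousWithinAt (fun u => g (-Real.log u)) (Ioi 0) 0 := by
        unfold ContinuousWithinAt
        simpa [hg0] using this
      exact (continuousWithinAt_insert_self.mpr h2).mono (by
        intro v hv
        rcases hv.1.eq_or_lt with rfl | h
        · simp
        · exact Or.inr h)
    · exact (hg.continuous.continuousAt.comp (Real.continuousAt_log hu0.ne').neg).continuousWithinAt
  have hpoly : ∀ p : Polynomial ℝ, IntegrableOn (fun t => p.eval (Real.exp (-t)) * h t) (Ioi 0) ∧
      ∫ t in Ioi (0:ℝ), p.eval (Real.exp (-t)) * h t = 0 := by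
    have hmon : ∀ n : ℕ, IntegrableOn (fun t => Real.exp (-t) ^ n * h t) (Ioi 0) := by
      intro n
      refine hi.bdd_mul (c := 1) (by fun_prop) ?_
      filter_upwards [ae_restrict_mem measurableSet_Ioi] with t ht
      rw [Real.norm_of_nonneg (by positivity)]
      exact pow_le_one₀ (Real.exp_pos _).le (Real.exp_le_one_iff.mpr (by simpa using le_of_lt ht))
    intro p
    induction p using Polynomial.induction_on' with
    | add p q hp hq =>
      simp only [Polynomial.eval_add, add_mul]
      exact ⟨hp.1.add hq.1, by rw [integral_add hp.1 hq.1, hp.2, hq.2, add_zero]⟩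
    | monomial n a =>
      simp only [Polynomial.eval_monomial, mul_assoc]
      exact ⟨(hmon n).const_mul a, by rw [integral_const_mul, hz, mul_zero]⟩
  have hwhole : ∫ t, g t • h t = ∫ t in Ioi (0:ℝ), g t * h t := by
    rw [setIntegral_eq_integral_of_forall_compl_eq_zero]
    · rfl
    · intro t ht
      rw [hg0 t (not_lt.mp ht), zero_mul]
  rw [hwhole]
  have hgi : IntegrableOn (fun t => g t * h t) (Ioi 0) := by
    obtain ⟨C, hC⟩ := hgc.exists_bound_of_continuous hg.continuous
    exact hi.bdd_mul (c := C) (hg.continuous.aestronglyMeasurable) (Filter.Eventually.of_forall hC)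
  have key : ∀ ε > 0, |∫ t in Ioi (0:ℝ), g t * h t| ≤ ε * ∫ t in Ioi (0:ℝ), |h t| := by
    intro ε hε
    obtain ⟨p, hp⟩ := exists_polynomial_near_of_continuousOn 0 1 _ hcont ε hε
    have e1 : ∫ t in Ioi (0:ℝ), g t * h t =
        ∫ t in Ioi (0:ℝ), (g t * h t - p.eval (Real.exp (-t)) * h t) := by
      rw [integral_sub hgi (hpoly p).1, (hpoly p).2, sub_zero]
    rw [e1, ← integral_const_mul, ← Real.norm_eq_abs]
    refine norm_integral_le_of_norm_le (hi.abs.const_mul ε) ?_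
    filter_upwards [ae_restrict_mem measurableSet_Ioi] with t ht
    rw [← sub_mul, norm_mul]
    refine mul_le_mul_of_nonneg_right ?_ (norm_nonneg _)
    have := hp (Real.exp (-t)) ⟨(Real.exp_pos _).le, Real.exp_le_one_iff.mpr (by simpa using le_of_lt ht)⟩
    rw [Real.log_exp, neg_neg, abs_sub_comm] at this
    exact this.le
  by_contra hne
  have hpos : 0 < |∫ t in Ioi (0:ℝ), g t * h t| := abs_pos.mpr hne
  set I := ∫ t in Ioi (0:ℝ), |h t|
  have hI : 0 ≤ I := integral_nonneg (fun _ => abs_nonneg _)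
  have := key (|∫ t in Ioi (0:ℝ), g t * h t| / (2 * (I + 1))) (by positivity)
  rw [div_mul_eq_mul_div, le_div_iff₀ (by positivity)] at this
  nlinarith

theorem lap_unique (f g : ℝ → ℝ)
    (hf : ∀ s : ℝ, 0 < s → IntegrableOn (fun t => Real.exp (-s * t) * f t) (Ioi 0))
    (hg : ∀ s : ℝ, 0 < s → IntegrableOn (fun t => Real.exp (-s * t) * g t) (Ioi 0))
    (he : ∀ s : ℝ, 0 < s → ∫ t in Ioi (0:ℝ), Real.exp (-s * t) * f t =
      ∫ t in Ioi (0:ℝ), Real.exp (-s * t) * g t) :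
    f =ᵐ[volume.restrict (Ioi 0)] g := by
  have := lap_zero (fun t => Real.exp (-1 * t) * f t - Real.exp (-1 * t) * g t)
    ((hf 1 one_pos).sub (hg 1 one_pos)) (by
      intro n
      have hn : (0:ℝ) < n + 1 := by positivity
      have := he (n+1) hn
      rw [← sub_eq_zero, ← integral_sub (hf _ hn) (hg _ hn)] at this
      refine Eq.trans ?_ this
      refine integral_congr_ae (Filter.Eventually.of_forall fun t => ?_)
      simp only
      rw [← Real.exp_nat_mul, mul_sub, ← mul_assoc, ← mul_assoc, ← Real.exp_add]
      ring_nf)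
  rw [Filter.EventuallyEq, ae_restrict_iff' measurableSet_Ioi]
  filter_upwards [this] with t ht h0
  have := ht h0
  rw [← mul_sub] at this
  rcases mul_eq_zero.mp this with h | h
  · exact absurd h (Real.exp_pos _).ne'
  · linarith

/-- Fubini for Laplace transforms -/
theorem lap_fubini (q : ℝ → ℝ → ℝ) (hq : Measurable (Function.uncurry q))
    (hq0 : ∀ t τ : ℝ, 0 < t → 0 < τ → 0 ≤ q t τ) (s : ℝ) (w : ℝ → ℝ)
    (hw : ∀ τ : ℝ, 0 < τ → IntegrableOn (fun t => Real.exp (-s * t) * q t τ) (Ioi 0) ∧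
      ∫ t in Ioi (0:ℝ), Real.exp (-s * t) * q t τ = w τ)
    (hwi : IntegrableOn w (Ioi 0)) (φ : ℝ → ℝ) (hφ : Continuous φ) (M : ℝ)
    (hM : ∀ τ, 0 ≤ τ → |φ τ| ≤ M) :
    IntegrableOn (fun t => Real.exp (-s * t) * ∫ τ in Ioi (0:ℝ), q t τ * φ τ) (Ioi 0) ∧
    ∫ t in Ioi (0:ℝ), Real.exp (-s * t) * ∫ τ in Ioi (0:ℝ), q t τ * φ τ =
      ∫ τ in Ioi (0:ℝ), w τ * φ τ := by
  have hint : Integrable (Function.uncurry fun t τ => Real.exp (-s * t) * (q t τ * φ τ))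
      ((volume.restrict (Ioi 0)).prod (volume.restrict (Ioi (0:ℝ)))) := by
    have hmeas : Measurable (Function.uncurry fun t τ => Real.exp (-s * t) * (q t τ * φ τ)) := by
      have h1 : Measurable (fun z : ℝ × ℝ => q z.1 z.2) := hq
      have h2 : Measurable φ := hφ.measurable
      change Measurable (fun z : ℝ × ℝ => Real.exp (-s * z.1) * (q z.1 z.2 * φ z.2))
      fun_prop
    rw [integrable_prod_iff' hmeas.aestronglyMeasurable]
    constructor
    · filter_upwards [ae_restrict_mem measurableSet_Ioi] with τ hτ
      have := (hw τ hτ).1.mul_const (φ τ)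
      simpa [Function.uncurry, mul_assoc, IntegrableOn] using this
    · have : IntegrableOn (fun τ => w τ * |φ τ|) (Ioi 0) := by
        refine hwi.mul_bdd (c := M) hφ.abs.aestronglyMeasurable ?_
        filter_upwards [ae_restrict_mem measurableSet_Ioi] with τ hτ
        simpa using hM τ (le_of_lt hτ)
      refine this.congr_fun ?_ measurableSet_Ioi
      intro τ hτ
      simp only
      rw [← (hw τ hτ).2, ← integral_mul_const]
      refine setIntegral_congr_fun measurableSet_Ioi ?_
      intro t ht
      simp only [Function.uncurry]
      rw [norm_mul, norm_mul, Real.norm_of_nonneg (Real.exp_pos _).le,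
        Real.norm_of_nonneg (hq0 t τ ht hτ), mul_assoc]
      rfl
  have h1 := hint.integral_prod_left
  have h2 := integral_integral_swap hint
  simp only [Function.uncurry, integral_const_mul] at h1 h2
  refine ⟨h1, h2.trans ?_⟩
  refine setIntegral_congr_fun measurableSet_Ioi ?_
  intro τ hτ
  simp only
  rw [← (hw τ hτ).2, ← integral_mul_const]
  simp only [mul_assoc]

/-- The one-sided stable density. -/
theorem lap_stable (α : ℝ) (hα0 : 0 < α) (f : ℝ → ℝ) (hf : Measurable f)
    (hf0 : ∀ t, 0 < t → 0 ≤ f t) (τ : ℝ) (hτ : 0 < τ)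
    (hlap : ∀ s : ℝ, 0 < s →
      IntegrableOn (fun t : ℝ => Real.exp (-s * t) * f t) (Ioi 0) ∧
      ∫ t in Ioi (0 : ℝ), Real.exp (-s * t) * f t = s ^ (α - 1) * Real.exp (-τ * s ^ α))
    (s : ℝ) (hs : 0 < s) :
    IntegrableOn (fun t : ℝ => Real.exp (-s * t) * (α * τ * f t / t)) (Ioi 0) ∧
    ∫ t in Ioi (0 : ℝ), Real.exp (-s * t) * (α * τ * f t / t) = Real.exp (-τ * s ^ α) := by
  have hd : ∀ σ ∈ Ici s, HasDerivAt (fun σ => -Real.exp (-τ * σ ^ α))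
      (α * τ * (σ ^ (α - 1) * Real.exp (-τ * σ ^ α))) σ := by
    intro σ hσ
    have hσ0 : 0 < σ := lt_of_lt_of_le hs hσ
    have := (((Real.hasDerivAt_rpow_const (p := α) (Or.inl hσ0.ne')).const_mul (-τ)).exp).neg
    exact this.congr_deriv (by ring)
  have hlim : Filter.Tendsto (fun σ => -Real.exp (-τ * σ ^ α)) Filter.atTop (nhds 0) := by
    have h1 := (tendsto_rpow_atTop hα0).const_mul_atTop_of_neg (neg_lt_zero.mpr hτ)
    simpa using (Real.tendsto_exp_atBot.comp h1).neg
  have hpos : ∀ σ ∈ Ioi s, 0 ≤ α * τ * (σ ^ (α - 1) * Real.exp (-τ * σ ^ α)) := by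
    intro σ hσ
    have hσ0 : 0 < σ := lt_trans hs hσ
    positivity
  have hi := integrableOn_Ioi_deriv_of_nonneg' hd hpos hlim
  have hI := integral_Ioi_of_hasDerivAt_of_tendsto' hd hi hlim
  have hint : Integrable (Function.uncurry fun t σ => Real.exp (-σ * t) * (α * τ * f t))
      ((volume.restrict (Ioi 0)).prod (volume.restrict (Ioi s))) := by
    have hmeas : Measurable (Function.uncurry fun t σ => Real.exp (-σ * t) * (α * τ * f t)) := by
      change Measurable (fun z : ℝ × ℝ => Real.exp (-z.2 * z.1) * (α * τ * f z.1))
      fun_prop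
    rw [integrable_prod_iff' hmeas.aestronglyMeasurable]
    constructor
    · filter_upwards [ae_restrict_mem measurableSet_Ioi] with σ hσ
      have := (hlap σ (hs.trans hσ)).1.const_mul (α * τ)
      refine this.congr (Filter.Eventually.of_forall fun t => ?_)
      simp only [Function.uncurry]; ring
    · refine hi.congr_fun ?_ measurableSet_Ioi
      intro σ hσ
      simp only
      rw [← (hlap σ (hs.trans hσ)).2, ← integral_const_mul]
      refine setIntegral_congr_fun measurableSet_Ioi ?_
      intro t ht
      have := hf0 t ht
      simp only [Function.uncurry]
      rw [Real.norm_of_nonneg (by positivity)]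
      ring
  have h1 := hint.integral_prod_left
  have h2 := integral_integral_swap hint
  simp only [Function.uncurry, integral_mul_const] at h1 h2
  have e : ∀ t ∈ Ioi (0:ℝ), (∫ σ in Ioi s, Real.exp (-σ * t)) * (α * τ * f t) =
      Real.exp (-s * t) * (α * τ * f t / t) := by
    intro t ht
    have := integral_exp_mul_Ioi (neg_lt_zero.mpr ht) s
    have e2 : ∫ σ in Ioi s, Real.exp (-σ * t) = Real.exp (-s * t) / t := by
      calc _ = ∫ σ in Ioi s, Real.exp (-t * σ) := by congr 1; ext σ; ring_nf
        _ = _ := by rw [this, neg_div_neg_eq]; ring_nf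
    rw [e2]; ring
  refine ⟨IntegrableOn.congr_fun h1 e measurableSet_Ioi, ?_⟩
  rw [← setIntegral_congr_fun measurableSet_Ioi e, h2]
  calc _ = ∫ σ in Ioi s, α * τ * (σ ^ (α - 1) * Real.exp (-τ * σ ^ α)) := by
        refine setIntegral_congr_fun measurableSet_Ioi ?_
        intro σ hσ
        simp only
        rw [← (hlap σ (hs.trans hσ)).2, ← integral_const_mul]
        congr 1; ext t; ring
    _ = _ := by rw [hI]; ring

/-- Laplace transform of a convolution on the half line. -/
theorem lap_conv (K k : ℝ → ℝ) (s : ℝ)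
    (hK : IntegrableOn (fun t => Real.exp (-s * t) * K t) (Ioi 0))
    (hk : IntegrableOn (fun t => Real.exp (-s * t) * k t) (Ioi 0)) :
    IntegrableOn (fun t => Real.exp (-s * t) * ∫ u in (0:ℝ)..t, k (t - u) * K u) (Ioi 0) ∧
    ∫ t in Ioi (0:ℝ), Real.exp (-s * t) * ∫ u in (0:ℝ)..t, k (t - u) * K u =
      (∫ t in Ioi (0:ℝ), Real.exp (-s * t) * K t) * ∫ t in Ioi (0:ℝ), Real.exp (-s * t) * k t := by
  have h1 := integrable_posConvolution (μ := volume) (ν := volume) hK hk (ContinuousLinearMap.mul ℝ ℝ)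
  have h2 := integral_posConvolution (μ := volume) (ν := volume) hK hk (ContinuousLinearMap.mul ℝ ℝ)
  have e : ∀ t, ∫ u in (0:ℝ)..t, ContinuousLinearMap.mul ℝ ℝ (Real.exp (-s * u) * K u)
      (Real.exp (-s * (t - u)) * k (t - u)) =
      Real.exp (-s * t) * ∫ u in (0:ℝ)..t, k (t - u) * K u := by
    intro t
    rw [← intervalIntegral.integral_const_mul]
    congr 1; ext u
    rw [ContinuousLinearMap.mul_apply', show -s * t = -s * u + -s * (t - u) by ring, Real.exp_add]
    ring
  unfold posConvolution at h1
  rw [integrable_indicator_iff measurableSet_Ioi] at h1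
  simp only [e] at h1 h2
  exact ⟨h1, h2⟩

theorem lap_ibp (y : ℝ → ℝ) (hy : ContDiff ℝ 1 y) (M : ℝ)
    (hM : ∀ t, 0 ≤ t → |y t| ≤ M) (hM' : ∀ t, 0 ≤ t → |deriv y t| ≤ M) (c : ℝ) (hc : 0 < c) :
    c * ∫ τ in Ioi (0:ℝ), Real.exp (-τ * c) * y τ =
      y 0 + ∫ τ in Ioi (0:ℝ), Real.exp (-τ * c) * deriv y τ := by
  have hexp : IntegrableOn (fun τ => Real.exp (-τ * c)) (Ioi 0) := by
    have := exp_neg_integrableOn_Ioi 0 hc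
    refine this.congr_fun (fun τ _ => ?_) measurableSet_Ioi
    ring_nf
  have hdc : Continuous (deriv y) := hy.continuous_deriv le_rfl
  have i1 : IntegrableOn (fun τ => Real.exp (-τ * c) * y τ) (Ioi 0) := by
    refine hexp.mul_bdd (c := M) hy.continuous.aestronglyMeasurable ?_
    filter_upwards [ae_restrict_mem measurableSet_Ioi] with τ hτ
    exact hM τ (le_of_lt hτ)
  have i2 : IntegrableOn (fun τ => Real.exp (-τ * c) * deriv y τ) (Ioi 0) := by
    refine hexp.mul_bdd (c := M) hdc.aestronglyMeasurable ?_
    filter_upwards [ae_restrict_mem measurableSet_Ioi] with τ hτ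
    exact hM' τ (le_of_lt hτ)
  have hd : ∀ τ ∈ Ici (0:ℝ), HasDerivAt (fun τ => Real.exp (-τ * c) * y τ)
      (-c * (Real.exp (-τ * c) * y τ) + Real.exp (-τ * c) * deriv y τ) τ := by
    intro τ _
    have h1 : HasDerivAt (fun τ : ℝ => Real.exp (-τ * c)) (Real.exp (-τ * c) * (-1 * c)) τ :=
      (((hasDerivAt_id τ).neg).mul_const c).exp
    have h2 : HasDerivAt y (deriv y τ) τ := (hy.differentiable one_ne_zero τ).hasDerivAt
    exact (h1.mul h2).congr_deriv (by ring)
  have hlim : Filter.Tendsto (fun τ => Real.exp (-τ * c) * y τ) Filter.atTop (nhds 0) := by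
    have h0 : Filter.Tendsto (fun τ : ℝ => Real.exp (-τ * c) * M) Filter.atTop (nhds 0) := by
      have : Filter.Tendsto (fun τ : ℝ => -τ * c) Filter.atTop Filter.atBot :=
        Filter.tendsto_neg_atTop_atBot.atBot_mul_const hc
      simpa using (Real.tendsto_exp_atBot.comp this).mul_const M
    refine squeeze_zero_norm' ?_ h0
    filter_upwards [Filter.eventually_ge_atTop 0] with τ hτ
    rw [norm_mul, Real.norm_of_nonneg (Real.exp_pos _).le]
    exact mul_le_mul_of_nonneg_left (hM τ hτ) (Real.exp_pos _).le
  have := integral_Ioi_of_hasDerivAt_of_tendsto' hd ((i1.const_mul (-c)).add i2) hlim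
  rw [integral_add (i1.const_mul (-c)) i2, integral_const_mul] at this
  simp only [neg_zero, zero_mul, Real.exp_zero, one_mul, zero_sub] at this
  linarith

theorem caputo_avg (α : ℝ) (hα0 : 0 < α) (hα1 : α < 1)
    (pd : ℝ → ℝ → ℝ)
    (hmeas : Measurable (Function.uncurry pd))
    (hnonneg : ∀ t τ : ℝ, 0 < t → 0 ≤ τ → 0 ≤ pd t τ)
    (hlap : ∀ s τ : ℝ, 0 < s → 0 ≤ τ →
      IntegrableOn (fun t : ℝ => Real.exp (-s * t) * pd t τ) (Ioi 0) ∧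
      ∫ t in Ioi (0 : ℝ), Real.exp (-s * t) * pd t τ = s ^ (α - 1) * Real.exp (-τ * s ^ α))
    (y : ℝ → ℝ) (hy : ContDiff ℝ 1 y) (M : ℝ)
    (hM : ∀ t, 0 ≤ t → |y t| ≤ M) (hM' : ∀ t, 0 ≤ t → |deriv y t| ≤ M)
    (yα : ℝ → ℝ)
    (hyα : ∀ t : ℝ, 0 < t → yα t = ∫ τ in Ioi (0 : ℝ), pd t τ * y τ)
    (hyαC : ContDiffOn ℝ 1 yα (Ioi 0))
    (hc : ContinuousOn (fun t => caputoL 0 α yα t) (Ioi 0))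
    (hG : ContinuousOn (fun t => ∫ τ in Ioi (0 : ℝ), pd t τ * deriv y τ) (Ioi 0)) :
    ∀ t, 0 < t → caputoL 0 α yα t = ∫ τ in Ioi (0 : ℝ), pd t τ * deriv y τ := by
  have hdc : Continuous (deriv y) := hy.continuous_deriv le_rfl
  have hexp : ∀ s : ℝ, 0 < s → IntegrableOn (fun τ => Real.exp (-τ * s ^ α)) (Ioi 0) := by
    intro s hs
    have := exp_neg_integrableOn_Ioi 0 (Real.rpow_pos_of_pos hs α)
    refine this.congr_fun (fun τ _ => ?_) measurableSet_Ioi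
    ring_nf
  have LA : ∀ (φ : ℝ → ℝ), Continuous φ → (∀ t, 0 ≤ t → |φ t| ≤ M) → ∀ s : ℝ, 0 < s → _ :=
    fun φ hφ hφM s hs => lap_fubini pd hmeas (fun t τ ht hτ => hnonneg t τ ht hτ.le) s
      (fun τ => s ^ (α - 1) * Real.exp (-τ * s ^ α)) (fun τ hτ => hlap s τ hs hτ.le)
      ((hexp s hs).const_mul _) φ hφ M hφM
  set K : ℝ → ℝ := fun t => ∫ τ in Ioi (0:ℝ), (α * τ * pd t τ / t) * deriv y τ with hKdef
  have LK : ∀ s : ℝ, 0 < s → _ := fun s hs => lap_fubini (fun t τ => α * τ * pd t τ / t)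
    (by
      have h1 : Measurable (fun z : ℝ × ℝ => pd z.1 z.2) := hmeas
      change Measurable (fun z : ℝ × ℝ => α * z.2 * pd z.1 z.2 / z.1)
      fun_prop)
    (fun t τ ht hτ => by have := hnonneg t τ ht hτ.le; positivity) s
    (fun τ => Real.exp (-τ * s ^ α))
    (fun τ hτ => lap_stable α hα0 (fun t => pd t τ) (hmeas.of_uncurry_right)
      (fun t ht => hnonneg t τ ht hτ.le) τ hτ (fun s hs => hlap s τ hs hτ.le) s hs)
    (hexp s hs) (deriv y) hdc M hM'
  have k1 : ∀ s : ℝ, 0 < s → IntegrableOn (fun t : ℝ => Real.exp (-s * t) * (1:ℝ)) (Ioi 0) ∧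
      ∫ t in Ioi (0:ℝ), Real.exp (-s * t) * (1:ℝ) = 1 / s := by
    intro s hs
    simp only [mul_one]
    refine ⟨exp_neg_integrableOn_Ioi 0 hs, ?_⟩
    rw [integral_exp_mul_Ioi (neg_lt_zero.mpr hs)]
    simp [neg_div_neg_eq]
  have k2 : ∀ s : ℝ, 0 < s → IntegrableOn (fun t : ℝ => Real.exp (-s * t) * t ^ (-α)) (Ioi 0) ∧
      ∫ t in Ioi (0:ℝ), Real.exp (-s * t) * t ^ (-α) = s ^ (α - 1) * Real.Gamma (1 - α) := by
    intro s hs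
    constructor
    · have := integrableOn_rpow_mul_exp_neg_mul_rpow (p := 1) (s := -α) (b := s) (by linarith)
        one_pos hs
      simp only [Real.rpow_one] at this
      simpa only [mul_comm] using this
    · have := Real.integral_rpow_mul_exp_neg_mul_Ioi (a := 1 - α) (r := s) (by linarith) hs
      rw [one_div, Real.inv_rpow hs.le, ← Real.rpow_neg hs.le, neg_sub] at this
      rw [← this]
      refine integral_congr_ae (Filter.Eventually.of_forall fun t => ?_)
      simp only
      rw [mul_comm, show 1 - α - 1 = -α by ring, neg_mul]
  have hKi : ∀ b : ℝ, IntegrableOn K (Ioc 0 b) := by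
    intro b
    have h1 : IntegrableOn (fun t => Real.exp (-1 * t) * K t) (Ioc 0 b) :=
      (LK 1 one_pos).1.mono_set Ioc_subset_Ioi_self
    have h2 : IntegrableOn (fun t => Real.exp t * (Real.exp (-1 * t) * K t)) (Ioc 0 b) := by
      refine h1.bdd_mul (c := Real.exp b) Real.continuous_exp.aestronglyMeasurable ?_
      filter_upwards [ae_restrict_mem measurableSet_Ioc] with t ht
      rw [Real.norm_of_nonneg (Real.exp_pos _).le]
      exact Real.exp_le_exp.mpr ht.2
    refine h2.congr_fun (fun t _ => ?_) measurableSet_Ioc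
    simp only
    rw [← mul_assoc, ← Real.exp_add]
    simp
  set K' : ℝ → ℝ := (Ioi 0).indicator K with hK'
  have hK'i : ∀ a b : ℝ, IntervalIntegrable K' volume a b := by
    intro a b
    rw [intervalIntegrable_iff, hK', IntegrableOn, integrable_indicator_iff measurableSet_Ioi,
      IntegrableOn, Measure.restrict_restrict measurableSet_Ioi]
    refine (hKi (max a b)).mono_set ?_
    intro t ht
    exact ⟨ht.1, ht.2.2⟩
  have hK'l : LocallyIntegrable K' volume := by
    rw [MeasureTheory.locallyIntegrable_iff]
    intro k hk
    obtain ⟨r, hr⟩ := hk.isBounded.subset_closedBall 0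
    rw [Real.closedBall_eq_Icc] at hr
    rcases le_total (0 - r) (0 + r) with h | h
    · exact ((intervalIntegrable_iff_integrableOn_Icc_of_le h).mp (hK'i _ _)).mono_set hr
    · refine IntegrableOn.mono_set ?_ (hr.trans (Icc_subset_Icc h le_rfl))
      simp
  have hKK' : ∀ t, 0 < t → ∀ k : ℝ → ℝ, ∫ u in (0:ℝ)..t, k u * K u = ∫ u in (0:ℝ)..t, k u * K' u := by
    intro t ht k
    rw [intervalIntegral.integral_of_le ht.le, intervalIntegral.integral_of_le ht.le]
    refine setIntegral_congr_fun measurableSet_Ioc fun u hu => ?_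
    simp only [hK']
    rw [indicator_of_mem (show u ∈ Ioi 0 from hu.1)]
  have hJ : EqOn yα (fun t => y 0 + ∫ u in (0:ℝ)..t, K' u) (Ioi 0) := by
    have hae : yα =ᵐ[volume.restrict (Ioi 0)] (fun t => y 0 * 1 + ∫ u in (0:ℝ)..t, 1 * K u) := by
      have hL1 : ∀ s : ℝ, 0 < s → IntegrableOn (fun t => Real.exp (-s * t) * yα t) (Ioi 0) ∧
          ∫ t in Ioi (0:ℝ), Real.exp (-s * t) * yα t =
            ∫ τ in Ioi (0:ℝ), s ^ (α - 1) * Real.exp (-τ * s ^ α) * y τ := by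
        intro s hs
        have h := LA y hy.continuous hM s hs
        have e : ∀ t ∈ Ioi (0:ℝ), Real.exp (-s * t) * (∫ τ in Ioi (0:ℝ), pd t τ * y τ) =
            Real.exp (-s * t) * yα t := fun t ht => by rw [hyα t ht]
        exact ⟨h.1.congr_fun e measurableSet_Ioi,
          (setIntegral_congr_fun measurableSet_Ioi e).symm.trans h.2⟩
      have hL2 : ∀ s : ℝ, 0 < s → IntegrableOn (fun t => Real.exp (-s * t) *
          (y 0 * 1 + ∫ u in (0:ℝ)..t, 1 * K u)) (Ioi 0) ∧
          ∫ t in Ioi (0:ℝ), Real.exp (-s * t) * (y 0 * 1 + ∫ u in (0:ℝ)..t, 1 * K u) =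
            (y 0 + ∫ τ in Ioi (0:ℝ), Real.exp (-τ * s ^ α) * deriv y τ) / s := by
        intro s hs
        have h := lap_conv K (fun _ => 1) s (LK s hs).1 (k1 s hs).1
        have hk := (k1 s hs).1.const_mul (y 0)
        have e : ∀ t : ℝ, Real.exp (-s * t) * (y 0 * 1 + ∫ u in (0:ℝ)..t, 1 * K u) =
          y 0 * (Real.exp (-s * t) * 1) + Real.exp (-s * t) * ∫ u in (0:ℝ)..t, 1 * K u :=
          fun t => by ring
        simp only [e]
        refine ⟨hk.add h.1, ?_⟩
        rw [integral_add hk h.1, integral_const_mul, h.2, (k1 s hs).2, (LK s hs).2]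
        ring
      refine lap_unique _ _ (fun s hs => (hL1 s hs).1) (fun s hs => (hL2 s hs).1) fun s hs => ?_
      rw [(hL1 s hs).2, (hL2 s hs).2, ← lap_ibp y hy M hM hM' _ (Real.rpow_pos_of_pos hs α)]
      simp only [mul_assoc]
      rw [integral_const_mul, Real.rpow_sub_one hs.ne']
      ring
    have hae2 : yα =ᵐ[volume.restrict (Ioi 0)] (fun t => y 0 + ∫ u in (0:ℝ)..t, K' u) := by
      filter_upwards [hae, ae_restrict_mem measurableSet_Ioi] with t h ht
      rw [h, hKK' t ht]
      simp
    refine Measure.eqOn_open_of_ae_eq hae2 isOpen_Ioi hyαC.continuousOn ?_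
    exact (continuous_const.add (intervalIntegral.continuous_primitive hK'i 0)).continuousOn
  have hderiv : ∀ᵐ t, t ∈ Ioi (0:ℝ) → deriv yα t = K t := by
    filter_upwards [_root_.LocallyIntegrable.ae_hasDerivAt_integral hK'l] with t ht h0
    have h1 : HasDerivAt (fun t => y 0 + ∫ u in (0:ℝ)..t, K' u) (K' t) t := (ht 0).const_add _
    have h2 : yα =ᶠ[nhds t] (fun t => y 0 + ∫ u in (0:ℝ)..t, K' u) :=
      Filter.eventuallyEq_of_mem (isOpen_Ioi.mem_nhds h0) hJ
    rw [(h1.congr_of_eventuallyEq h2).deriv, hK', indicator_of_mem h0]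
  have hcap : ∀ t ∈ Ioi (0:ℝ), caputoL 0 α yα t =
      (Real.Gamma (1 - α))⁻¹ * ∫ u in (0:ℝ)..t, (t - u) ^ (-α) * K u := by
    intro t ht
    unfold caputoL
    congr 1
    refine intervalIntegral.integral_congr_ae ?_
    filter_upwards [hderiv] with u hu hu2
    rw [uIoc_of_le (le_of_lt ht)] at hu2
    rw [hu hu2.1]
  have hfin : (fun t => caputoL 0 α yα t) =ᵐ[volume.restrict (Ioi 0)]
      (fun t => ∫ τ in Ioi (0 : ℝ), pd t τ * deriv y τ) := by
    have hL : ∀ s : ℝ, 0 < s → IntegrableOn (fun t => Real.exp (-s * t) * caputoL 0 α yα t) (Ioi 0) ∧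
        ∫ t in Ioi (0:ℝ), Real.exp (-s * t) * caputoL 0 α yα t =
          s ^ (α - 1) * ∫ τ in Ioi (0:ℝ), Real.exp (-τ * s ^ α) * deriv y τ := by
      intro s hs
      have h := lap_conv K (fun t => t ^ (-α)) s (LK s hs).1 (k2 s hs).1
      have e : ∀ t ∈ Ioi (0:ℝ), (Real.Gamma (1 - α))⁻¹ * (Real.exp (-s * t) *
          ∫ u in (0:ℝ)..t, (t - u) ^ (-α) * K u) = Real.exp (-s * t) * caputoL 0 α yα t := by
        intro t ht
        rw [hcap t ht]; ring
      refine ⟨IntegrableOn.congr_fun (h.1.const_mul _) e measurableSet_Ioi, ?_⟩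
      rw [← setIntegral_congr_fun measurableSet_Ioi e, integral_const_mul, h.2, (k2 s hs).2,
        (LK s hs).2]
      have : Real.Gamma (1 - α) ≠ 0 := (Real.Gamma_pos_of_pos (by linarith)).ne'
      generalize (∫ τ in Ioi (0:ℝ), Real.exp (-τ * s ^ α) * deriv y τ) = I
      field_simp
    refine lap_unique _ _ (fun s hs => (hL s hs).1) (fun s hs => (LA _ hdc hM' s hs).1)
      fun s hs => ?_
    rw [(hL s hs).2, (LA _ hdc hM' s hs).2]
    simp only [mul_assoc]
    rw [integral_const_mul]
  exact fun t ht => Measure.eqOn_open_of_ae_eq hfin isOpen_Ioi hc hG ht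

/-- Stanislavsky's theorem: for a bounded solution `(x,p)` of the canonical
equations, the commutation condition of the partial derivatives of `H` with the internal-time
average holds if and only if `(x_α, p_α)` satisfies the fractional Hamiltonian equations. -/
theorem stanislavsky_fractional_hamiltonian (α : ℝ) (hα0 : 0 < α) (hα1 : α < 1)
    (H Hx Hp : ℝ → ℝ → ℝ)
    (hHx : ∀ x p : ℝ, HasDerivAt (fun y => H y p) (Hx x p) x)
    (hHp : ∀ x p : ℝ, HasDerivAt (fun q => H x q) (Hp x p) p)
    (hHxc : Continuous fun z : ℝ × ℝ => Hx z.1 z.2)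
    (hHpc : Continuous fun z : ℝ × ℝ => Hp z.1 z.2)
    (x p : ℝ → ℝ) (hx : ContDiff ℝ 1 x) (hp : ContDiff ℝ 1 p)
    (hxeq : ∀ t : ℝ, 0 ≤ t → deriv x t = Hp (x t) (p t))
    (hpeq : ∀ t : ℝ, 0 ≤ t → deriv p t = -(Hx (x t) (p t)))
    (hbdd : ∃ M : ℝ, ∀ t : ℝ, 0 ≤ t →
      |x t| ≤ M ∧ |p t| ≤ M ∧ |deriv x t| ≤ M ∧ |deriv p t| ≤ M)
    (pd : ℝ → ℝ → ℝ)
    (hmeas : Measurable (Function.uncurry pd))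
    (hnonneg : ∀ t τ : ℝ, 0 < t → 0 ≤ τ → 0 ≤ pd t τ)
    (hlap : ∀ s τ : ℝ, 0 < s → 0 ≤ τ →
      IntegrableOn (fun t : ℝ => Real.exp (-s * t) * pd t τ) (Ioi 0) ∧
      ∫ t in Ioi (0 : ℝ), Real.exp (-s * t) * pd t τ = s ^ (α - 1) * Real.exp (-τ * s ^ α))
    (xα pα : ℝ → ℝ)
    (hint : ∀ t : ℝ, 0 < t →
      IntegrableOn (fun τ : ℝ => pd t τ * x τ) (Ioi 0) ∧
      IntegrableOn (fun τ : ℝ => pd t τ * p τ) (Ioi 0) ∧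
      IntegrableOn (fun τ : ℝ => pd t τ * Hx (x τ) (p τ)) (Ioi 0) ∧
      IntegrableOn (fun τ : ℝ => pd t τ * Hp (x τ) (p τ)) (Ioi 0))
    (hxα : ∀ t : ℝ, 0 < t → xα t = ∫ τ in Ioi (0 : ℝ), pd t τ * x τ)
    (hpα : ∀ t : ℝ, 0 < t → pα t = ∫ τ in Ioi (0 : ℝ), pd t τ * p τ)
    (hxαC : ContDiffOn ℝ 1 xα (Ioi 0)) (hpαC : ContDiffOn ℝ 1 pα (Ioi 0))
    (hreg : ∀ g ∈ ({fun t => caputoL 0 α xα t, fun t => caputoL 0 α pα t,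
        fun t => Hx (xα t) (pα t), fun t => Hp (xα t) (pα t),
        fun t => ∫ τ in Ioi (0 : ℝ), pd t τ * Hx (x τ) (p τ),
        fun t => ∫ τ in Ioi (0 : ℝ), pd t τ * Hp (x τ) (p τ)} : Set (ℝ → ℝ)),
      ContinuousOn g (Ioi 0) ∧
      ∃ M c : ℝ, ∀ t : ℝ, 0 < t → |g t| ≤ M * Real.exp (c * t)) :
    (∀ t : ℝ, 0 < t →
        Hx (xα t) (pα t) = (∫ τ in Ioi (0 : ℝ), pd t τ * Hx (x τ) (p τ)) ∧
        Hp (xα t) (pα t) = (∫ τ in Ioi (0 : ℝ), pd t τ * Hp (x τ) (p τ)))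
    ↔ (∀ t : ℝ, 0 < t →
        caputoL 0 α xα t = Hp (xα t) (pα t) ∧
        caputoL 0 α pα t = -(Hx (xα t) (pα t))) := by
  obtain ⟨M, hM⟩ := hbdd
  have ex : ∀ t, ∫ τ in Ioi (0:ℝ), pd t τ * deriv x τ =
      ∫ τ in Ioi (0:ℝ), pd t τ * Hp (x τ) (p τ) := fun t =>
    setIntegral_congr_fun measurableSet_Ioi fun τ hτ => by
      simp only [hxeq τ (le_of_lt hτ)]
  have ep : ∀ t, ∫ τ in Ioi (0:ℝ), pd t τ * deriv p τ =
      -∫ τ in Ioi (0:ℝ), pd t τ * Hx (x τ) (p τ) := fun t => by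
    rw [← integral_neg]
    exact setIntegral_congr_fun measurableSet_Ioi fun τ hτ => by
      simp only [hpeq τ (le_of_lt hτ), mul_neg]
  have cx := caputo_avg α hα0 hα1 pd hmeas hnonneg hlap x hx M (fun t ht => (hM t ht).1)
    (fun t ht => (hM t ht).2.2.1) xα hxα hxαC (hreg _ (by simp)).1
    (by simp only [ex]; exact (hreg _ (by simp)).1)
  have cp := caputo_avg α hα0 hα1 pd hmeas hnonneg hlap p hp M (fun t ht => (hM t ht).2.1)
    (fun t ht => (hM t ht).2.2.2) pα hpα hpαC (hreg _ (by simp)).1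
    (by simp only [ep]; exact (hreg _ (by simp)).1.neg)
  simp only [ex] at cx
  simp only [ep] at cp
  refine forall_congr' fun t => forall_congr' fun ht => ?_
  rw [cx t ht, cp t ht]
  constructor
  · rintro ⟨h1, h2⟩
    exact ⟨h2.symm, by rw [h1]⟩
  · rintro ⟨h1, h2⟩
    exact ⟨(neg_injective h2).symm, h1.symm⟩
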